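/- arXiv:math/0410476 — 2 statements merged into one kernel-verified Lean document; each statement's English description precedes it below -/
import Mathlib

section
/- Let n ≥ 1 and let f : S^n → S^{n+1} be a continuous map. If the set of injectivity I of f contains a nonempty open subset of S^n, then f is not surjective, i.e. f(S^n) ≠ S^{n+1}. -/
open Metric Set Module MeasureTheory

/-- A Lipschitz function on a closed set that vanishes on the frontier stays Lipschitz when extended
by zero. -/
theorem LipschitzOnWith.lipschitzWith_indicator {E F : Type*} [NormedAddCommGroup E]
    [NormedSpace ℝ E] [NormedAddCommGroup F] {s : Set E} {v : E → F} {K : NNReal}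
    (hv : LipschitzOnWith K v s) (hs : IsClosed s) (h0 : ∀ x ∈ frontier s, v x = 0) :
    LipschitzWith K (s.indicator v) := by
  have key : ∀ x ∈ s, ∀ y ∉ s, dist (s.indicator v x) (s.indicator v y) ≤ K * dist x y := by
    intro x hx y hy
    obtain ⟨z, hz, hzf⟩ : (segment ℝ x y ∩ frontier s).Nonempty := by
      rw [frontier_eq_closure_inter_closure, hs.closure_eq]
      refine isPreconnected_closed_iff.1 (convex_segment x y).isPreconnected _ _ hs
        isClosed_closure (fun z _ => ?_) ⟨x, left_mem_segment ℝ x y, hx⟩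
        ⟨y, right_mem_segment ℝ x y, subset_closure hy⟩
      exact (em (z ∈ s)).imp id fun h => subset_closure h
    have hzs : z ∈ s := hs.frontier_subset hzf
    calc dist (s.indicator v x) (s.indicator v y) = dist (v x) (v z) := by
          rw [indicator_of_mem hx, indicator_of_notMem hy, h0 z hzf]
      _ ≤ K * dist x z := hv.dist_le_mul x hx z hzs
      _ ≤ K * dist x y := by
          rw [← dist_add_dist_of_mem_segment hz]
          gcongr
          exact le_add_of_nonneg_right dist_nonneg
  refine LipschitzWith.of_dist_le_mul fun x y => ?_
  by_cases hx : x ∈ s <;> by_cases hy : y ∈ s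
  · simpa [hx, hy] using hv.dist_le_mul x hx y hy
  · exact key x hx y hy
  · rw [dist_comm, dist_comm x]
    exact key y hy x hx
  · simpa [hx, hy] using by positivity

/-- The function `t ↦ det (1 + t • A)` is polynomial of degree at most the dimension. -/
theorem LinearMap.exists_polynomial_eval_eq_det_one_add_smul {K M : Type*} [Field K]
    [AddCommGroup M] [Module K M] [FiniteDimensional K M] (A : M →ₗ[K] M) :
    ∃ p : Polynomial K, p.natDegree ≤ finrank K M ∧
      ∀ t : K, p.eval t = LinearMap.det (1 + t • A) := by
  classical
  let b := Module.finBasis K M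
  let B := LinearMap.toMatrix b b A
  refine ⟨((Polynomial.X : Polynomial K) • B.map Polynomial.C
    + (1 : Matrix _ _ K).map Polynomial.C).det, ?_, fun t => ?_⟩
  · simpa using Polynomial.natDegree_det_X_add_C_le B 1
  · rw [← LinearMap.det_toMatrix b, ← Polynomial.coe_evalRingHom, RingHom.map_det]
    congr 1
    ext i j
    by_cases hij : i = j <;> simp [B, hij, LinearMap.toMatrix_one] <;> ring

/-- Lagrange extrapolation: `det (1 + A)` is an affine combination, with weights independent of `A`,
of the values `det (1 + t • A)` at finitely many small positive `t`. -/
theorem exists_det_one_add_eq_sum_smul (M : Type*)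
    [AddCommGroup M] [Module ℝ M] [FiniteDimensional ℝ M] {δ : ℝ} (hδ : 0 < δ) :
    ∃ (s : Finset ℝ) (w : ℝ → ℝ), (∀ t ∈ s, t ∈ Ioo 0 δ) ∧ ∑ t ∈ s, w t = 1 ∧
      ∀ A : M →ₗ[ℝ] M,
        LinearMap.det (1 + A) = ∑ t ∈ s, w t * LinearMap.det (1 + t • A) := by
  obtain ⟨s, hs, hcard⟩ := (Ioo_infinite hδ).exists_subset_card_eq (finrank ℝ M + 1)
  have hinj : Set.InjOn id (s : Set ℝ) := injOn_id _
  refine ⟨s, fun t => (Lagrange.basis s (id : ℝ → ℝ) t).eval 1, fun t ht => hs ht, ?_, fun A => ?_⟩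
  · rw [← Polynomial.eval_finsetSum, Lagrange.sum_basis hinj (Finset.card_pos.1 (by lia)),
      Polynomial.eval_one]
  · obtain ⟨p, hp, hpA⟩ := A.exists_polynomial_eval_eq_det_one_add_smul
    have hdeg : p.degree < s.card :=
      Polynomial.degree_le_natDegree.trans_lt (by rw [hcard]; exact_mod_cast Nat.lt_succ_of_le hp)
    have := congrArg (Polynomial.eval 1) (Lagrange.eq_interpolate hinj hdeg)
    simpa [Lagrange.interpolate_apply, Polynomial.eval_finsetSum, hpA, mul_comm] using this

theorem ContinuousLinearMap.det_one_add_pos_of_norm_lt_one {E : Type*} [NormedAddCommGroup E]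
    [NormedSpace ℝ E] [FiniteDimensional ℝ E] {A : E →L[ℝ] E} (hA : ‖A‖ < 1) :
    0 < (1 + A).det := by
  have : CompleteSpace E := FiniteDimensional.complete ℝ E
  have hne : ∀ s ∈ Icc (0 : ℝ) 1, (1 + s • A).det ≠ 0 := by
    intro s hs
    have hu : IsUnit (1 - (-(s • A))) := isUnit_one_sub_of_norm_lt_one <| by
      rw [norm_neg, norm_smul, Real.norm_of_nonneg hs.1]
      exact (mul_le_of_le_one_left (norm_nonneg _) hs.2).trans_lt hA
    rw [sub_neg_eq_add] at hu
    exact ((hu.map (ContinuousLinearMap.toLinearMapRingHom (R₁ := ℝ) (M₁ := E))).map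
      LinearMap.det).ne_zero
  have hcont : Continuous fun s : ℝ => (1 + s • A).det :=
    ContinuousLinearMap.continuous_det.comp (by fun_prop)
  by_contra! h
  obtain ⟨s, hs, hs0⟩ := intermediate_value_Icc' (zero_le_one (α := ℝ)) hcont.continuousOn
    (show (0 : ℝ) ∈ _ from ⟨by simpa using h, by simp [ContinuousLinearMap.det]⟩)
  exact hne s hs hs0

/-- There is no `C¹` retraction of the closed unit ball onto the unit sphere (Milnor–Rogers). -/
theorem not_exists_contDiff_retraction_sphere {E : Type*} [NormedAddCommGroup E]
    [InnerProductSpace ℝ E] [FiniteDimensional ℝ E] {r : E → E} (hr : ContDiff ℝ 1 r)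
    (hnorm : ∀ x ∈ closedBall (0 : E) 1, ‖r x‖ = 1) :
    ¬ ∀ x ∈ sphere (0 : E) 1, r x = x := by
  intro hid
  borelize E
  obtain ⟨K, hK⟩ : ∃ K, LipschitzOnWith K (fun x => r x - x) (closedBall (0 : E) 1) :=
    (hr.sub contDiff_id).contDiffOn.exists_lipschitzOnWith one_ne_zero
      (convex_closedBall _ _) (isCompact_closedBall _ _)
  set u : E → E := (closedBall (0 : E) 1).indicator fun x => r x - x with hu
  have huK : LipschitzWith K u := hK.lipschitzWith_indicator isClosed_closedBall fun x hx =>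
    sub_eq_zero.2 (hid x (frontier_closedBall_subset_sphere hx))
  set A : E → E →L[ℝ] E := fun x => fderiv ℝ r x - 1 with hA
  have hAcont : Continuous A := (hr.continuous_fderiv one_ne_zero).sub continuous_const
  have huA : ∀ x ∈ ball (0 : E) 1, HasFDerivAt u (A x) x := by
    intro x hx
    have h : HasFDerivAt (fun x => r x - x) (A x) x :=
      (hr.differentiable one_ne_zero x).hasFDerivAt.sub (hasFDerivAt_id x)
    refine h.congr_of_eventuallyEq ?_
    filter_upwards [isOpen_ball.mem_nhds hx] with y hy
    exact indicator_of_mem (ball_subset_closedBall hy) _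
  have hδ : (0 : ℝ) < min (1 : ℝ) (1 / ((K : ℝ) + 1)) := by positivity
  obtain ⟨s, w, hs, hw, hdet⟩ := exists_det_one_add_eq_sum_smul E hδ
  have hvol : ∀ t ∈ s, ∫ x in ball (0 : E) 1, (1 + t • A x).det = volume.real (ball (0 : E) 1) := by
    intro t ht
    obtain ⟨ht0, htδ⟩ := hs t ht
    have ht1 : t < 1 := htδ.trans_le (min_le_left _ _)
    have htK : t * K < 1 := by
      have := (lt_div_iff₀ (by positivity)).1 (htδ.trans_le (min_le_right _ _))
      nlinarith
    have hlip : ∀ x y, ‖t • u x - t • u y‖ ≤ t * K * ‖x - y‖ := fun x y => by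
      rw [← smul_sub, norm_smul, Real.norm_of_nonneg ht0.le, mul_assoc]
      exact mul_le_mul_of_nonneg_left (huK.norm_sub_le x y) ht0.le
    set g : E → E := fun x => x + t • u x with hg
    have hinj : Function.Injective g := by
      intro x y hxy
      have h1 : x - y = t • u y - t • u x := by
        rw [sub_eq_sub_iff_add_eq_add, add_comm (t • u y)]
        exact hxy.trans (add_comm _ _) |>.trans (add_comm _ _)
      have h2 := hlip y x
      rw [← h1, norm_sub_rev y x] at h2
      have h3 : ‖x - y‖ = 0 := by nlinarith [norm_nonneg (x - y)]
      exact sub_eq_zero.1 (norm_eq_zero.1 h3)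
    have hsurj : Function.Surjective g := by
      intro y
      have hc : ContractingWith ⟨t * K, by positivity⟩ fun x => y - t • u x := by
        refine ⟨by exact_mod_cast htK, LipschitzWith.of_dist_le_mul fun x z => ?_⟩
        rw [dist_sub_left, dist_eq_norm, dist_eq_norm]
        exact hlip x z
      have := hc.fixedPoint_isFixedPt
      exact ⟨hc.fixedPoint _, by
        nth_rewrite 1 [hg]
        exact (sub_eq_iff_eq_add.1 this).symm⟩
    have hout : ∀ x ∉ ball (0 : E) 1, g x = x := by
      intro x hx
      have : u x = 0 := by
        by_cases hx' : x ∈ closedBall (0 : E) 1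
        · rw [hu, indicator_of_mem hx', hid x, sub_self]
          simp only [mem_ball, mem_closedBall, mem_sphere] at *
          linarith
        · exact indicator_of_notMem hx' _
      simp [hg, this]
    have himage : g '' ball (0 : E) 1 = ball 0 1 := by
      refine Subset.antisymm ?_ fun y hy => ?_
      · rintro _ ⟨x, hx, rfl⟩
        have hx' := ball_subset_closedBall hx
        have : g x = (1 - t) • x + t • r x := by
          simp only [hg, hu, indicator_of_mem hx', smul_sub, sub_smul, one_smul]
          abel
        rw [mem_ball_zero_iff] at hx ⊢
        calc ‖g x‖ ≤ (1 - t) * ‖x‖ + t * ‖r x‖ := by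
              rw [this]
              refine (norm_add_le _ _).trans_eq ?_
              rw [norm_smul, norm_smul, Real.norm_of_nonneg ht0.le,
                Real.norm_of_nonneg (sub_nonneg.2 ht1.le)]
          _ < 1 := by rw [hnorm x hx']; nlinarith
      · obtain ⟨x, rfl⟩ := hsurj y
        by_cases hx : x ∈ ball (0 : E) 1
        · exact mem_image_of_mem g hx
        · rw [hout x hx] at hy
          exact absurd hy hx
    have hderiv : ∀ x ∈ ball (0 : E) 1, HasFDerivWithinAt g (1 + t • A x) (ball 0 1) x :=
      fun x hx => ((hasFDerivAt_id x).add ((huA x hx).const_smul t)).hasFDerivWithinAt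
    have hchange := integral_image_eq_integral_abs_det_fderiv_smul volume measurableSet_ball
      hderiv hinj.injOn fun _ => (1 : ℝ)
    rw [himage, setIntegral_const] at hchange
    simp only [smul_eq_mul, mul_one] at hchange
    rw [hchange]
    refine setIntegral_congr_fun measurableSet_ball fun x hx => (abs_of_pos ?_).symm
    refine ContinuousLinearMap.det_one_add_pos_of_norm_lt_one ?_
    rw [norm_smul, Real.norm_of_nonneg ht0.le]
    exact (mul_le_mul_of_nonneg_left ((huA x hx).le_of_lipschitz huK) ht0.le).trans_lt htK
  have hzero : ∀ x ∈ ball (0 : E) 1, (1 + A x).det = 0 := by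
    intro x hx
    have hfx : 1 + A x = fderiv ℝ r x := by simp [hA]
    have horth : ∀ h, inner ℝ (r x) (fderiv ℝ r x h) = 0 := by
      intro h
      have h1 := (hr.differentiable one_ne_zero x).hasFDerivAt.norm_sq
      have h2 : HasFDerivAt (fun y => ‖r y‖ ^ 2) (0 : E →L[ℝ] ℝ) x := by
        refine (hasFDerivAt_const (1 : ℝ) x).congr_of_eventuallyEq ?_
        filter_upwards [isOpen_ball.mem_nhds hx] with y hy
        simp [hnorm y (ball_subset_closedBall hy)]
      simpa using congrArg (fun L : E →L[ℝ] ℝ => L h) (h1.unique h2)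
    rw [hfx]
    by_contra hne
    have hunit : IsUnit (fderiv ℝ r x : E →ₗ[ℝ] E) :=
      (LinearMap.isUnit_iff_isUnit_det _).2 (isUnit_iff_ne_zero.2 hne)
    obtain ⟨h, hh⟩ := ((Module.End.isUnit_iff _).1 hunit).2 (r x)
    have h0 := horth h
    rw [show fderiv ℝ r x h = r x from hh, inner_self_eq_zero] at h0
    simpa [h0] using hnorm x (ball_subset_closedBall hx)
  have hint : ∀ t : ℝ, IntegrableOn (fun x => (1 + t • A x).det) (ball (0 : E) 1) := fun t =>
    ((ContinuousLinearMap.continuous_det.comp (by fun_prop :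
      Continuous fun x => 1 + t • A x)).continuousOn.integrableOn_compact
        (isCompact_closedBall _ _)).mono_set ball_subset_closedBall
  have hpos : 0 < volume.real (ball (0 : E) 1) :=
    ENNReal.toReal_pos (measure_ball_pos _ _ one_pos).ne' measure_ball_lt_top.ne
  refine hpos.ne ?_
  calc 0 = ∫ x in ball (0 : E) 1, (1 + A x).det := by
        rw [setIntegral_congr_fun measurableSet_ball hzero]; simp
    _ = ∫ x in ball (0 : E) 1, ∑ t ∈ s, w t * (1 + t • A x).det := by
        congr 1 with x
        exact hdet (A x)
    _ = ∑ t ∈ s, w t * volume.real (ball (0 : E) 1) := by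
        rw [integral_finsetSum _ fun t _ => (hint t).const_mul (w t)]
        exact Finset.sum_congr rfl fun t ht => by rw [integral_const_mul, hvol t ht]
    _ = volume.real (ball (0 : E) 1) := by rw [← Finset.sum_mul, hw, one_mul]

/-- A continuous map that is uniformly close to the identity on the closed unit ball has a zero. -/
theorem exists_eq_zero_of_norm_sub_lt {E : Type*} [NormedAddCommGroup E]
    [InnerProductSpace ℝ E] [FiniteDimensional ℝ E] {F : E → E} (hF : Continuous F)
    (hFid : ∀ x ∈ closedBall (0 : E) 1, ‖F x - x‖ < 1 / 4) :
    ∃ x ∈ closedBall (0 : E) 1, F x = 0 := by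
  by_contra! hne
  obtain ⟨x₀, hx₀, hmin⟩ := (isCompact_closedBall (0 : E) 1).exists_isMinOn
    ⟨0, mem_closedBall_self zero_le_one⟩ hF.norm.continuousOn
  have hδ : 0 < min (1 / 4) ‖F x₀‖ := lt_min (by norm_num) (norm_pos_iff.2 (hne x₀ hx₀))
  obtain ⟨G, hG, hGF, -⟩ := hF.exists_contDiff_approx 1
    (continuous_const (y := min (1 / 4) ‖F x₀‖)) fun _ => hδ
  let χ : ContDiffBump (0 : E) := ⟨3 / 4, 1, by norm_num, by norm_num⟩
  set H : E → E := fun x => x + χ x • (G x - x) with hH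
  have hHout : ∀ x, 1 ≤ ‖x‖ → H x = x := fun x hx => by
    simp [hH, χ.zero_of_le_dist (x := x) (by simpa using hx)]
  have hHne : ∀ x, H x ≠ 0 := by
    intro x
    rcases le_or_gt 1 ‖x‖ with hx | hx
    · rw [hHout x hx]
      exact norm_pos_iff.1 (one_pos.trans_le hx)
    have hxb : x ∈ closedBall (0 : E) 1 := by simpa using hx.le
    have hd := lt_min_iff.1 (hGF x)
    rw [dist_eq_norm] at hd
    rcases le_or_gt ‖x‖ (3 / 4) with hx' | hx'
    · have h1 : H x = G x := by
        simp [hH, χ.one_of_mem_closedBall (x := x) (by simpa using hx')]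
      have h2 : ‖F x₀‖ ≤ ‖F x‖ := hmin hxb
      intro h0
      rw [← h1, h0, zero_sub, norm_neg] at hd
      exact absurd hd.2 h2.not_gt
    · intro h0
      have h1 : ‖G x - x‖ < 1 / 2 := by
        have := norm_sub_le_norm_sub_add_norm_sub (G x) (F x) x
        linarith [hFid x hxb, hd.1]
      have h2 : ‖x‖ = χ x * ‖G x - x‖ := by
        rw [← norm_neg x, neg_eq_of_add_eq_zero_right h0, norm_smul,
          Real.norm_of_nonneg χ.nonneg]
      nlinarith [χ.le_one (x := x), norm_nonneg (G x - x)]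
  have hHC : ContDiff ℝ 1 H := contDiff_id.add (χ.contDiff.smul (hG.sub contDiff_id))
  refine not_exists_contDiff_retraction_sphere (r := fun x => ‖H x‖⁻¹ • H x)
    (((hHC.norm ℝ hHne).inv fun x => norm_ne_zero_iff.2 (hHne x)).smul hHC) (fun x _ => ?_) ?_
  · simp [norm_smul, hHne x]
  · intro x hx
    have hx1 : ‖x‖ = 1 := by simpa using hx
    simp [hHout x hx1.ge, hx1]

/-- The closed unit ball does not embed continuously into a space of smaller dimension. -/
theorem not_injOn_closedBall_of_finrank_lt {E F : Type*} [NormedAddCommGroup E]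
    [InnerProductSpace ℝ E] [FiniteDimensional ℝ E] [NormedAddCommGroup F] [NormedSpace ℝ F]
    [FiniteDimensional ℝ F] (hEF : finrank ℝ F < finrank ℝ E) {g : E → F}
    (hg : ContinuousOn g (closedBall 0 1)) : ¬ InjOn g (closedBall 0 1) := by
  intro hinj
  have : CompactSpace (closedBall (0 : E) 1) := isCompact_iff_compactSpace.1
    (isCompact_closedBall _ _)
  have hemb : Topology.IsClosedEmbedding ((closedBall (0 : E) 1).domRestrict g) :=
    hg.domRestrict.isClosedEmbedding hinj.injective
  obtain ⟨h, hh⟩ := ContinuousMap.exists_extension' hemb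
    (⟨Subtype.val, continuous_subtype_val⟩ : C(closedBall (0 : E) 1, E))
  obtain ⟨k, hk⟩ := ContinuousMap.exists_restrict_eq isClosed_closedBall
    (⟨_, hg.domRestrict⟩ : C(closedBall (0 : E) 1, F))
  have hgk : ∀ x ∈ closedBall (0 : E) 1, k x = g x := fun x hx =>
    congrArg (fun φ : C(closedBall (0 : E) 1, F) => φ ⟨x, hx⟩) hk
  have hhg : ∀ x ∈ closedBall (0 : E) 1, h (g x) = x := fun x hx => congrFun hh ⟨x, hx⟩
  obtain ⟨H, hH, hHh, -⟩ := h.continuous.exists_contDiff_approx 1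
    (continuous_const (y := (1 / 8 : ℝ))) fun _ => by norm_num
  obtain ⟨p, hp, hpH⟩ := (hH.dense_compl_range_of_finrank_lt_finrank hEF).exists_dist_lt 0
    (show (0 : ℝ) < 1 / 8 by norm_num)
  rw [dist_zero_left] at hpH
  obtain ⟨x, -, hx⟩ := exists_eq_zero_of_norm_sub_lt (F := fun x => H (k x) - p)
    ((hH.continuous.comp k.continuous).sub continuous_const) fun x hx => by
      have h1 := hHh (g x)
      rw [hhg x hx, dist_eq_norm] at h1
      rw [hgk x hx, sub_right_comm]
      linarith [norm_sub_le (H (g x) - x) p]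
  exact hp ⟨k x, sub_eq_zero.1 hx⟩

/-- A nonempty open set does not embed continuously into a space of smaller dimension. -/
theorem IsOpen.not_injOn_of_finrank_lt {E F : Type*} [NormedAddCommGroup E]
    [InnerProductSpace ℝ E] [FiniteDimensional ℝ E] [NormedAddCommGroup F] [NormedSpace ℝ F]
    [FiniteDimensional ℝ F] (hEF : finrank ℝ F < finrank ℝ E) {g : E → F} {V : Set E}
    (hV : IsOpen V) (hVne : V.Nonempty) (hg : ContinuousOn g V) : ¬ InjOn g V := by
  intro hinj
  obtain ⟨a, ha⟩ := hVne
  obtain ⟨ε, hε, hεV⟩ := nhds_basis_closedBall.mem_iff.1 (hV.mem_nhds ha)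
  have hmaps : MapsTo (fun x : E => a + ε • x) (closedBall 0 1) V := fun x hx => hεV <| by
    rw [mem_closedBall_zero_iff] at hx
    simpa [norm_smul, abs_of_pos hε] using mul_le_of_le_one_right hε.le hx
  refine not_injOn_closedBall_of_finrank_lt hEF (hg.comp (by fun_prop) hmaps)
    (hinj.comp (fun x _ y _ hxy => ?_) hmaps)
  exact smul_right_injective E hε.ne' (add_left_cancel hxy)

/-- Let `n ≥ 1` and let `f : Sⁿ → Sⁿ⁺¹` be a continuous map.  If the set
of injectivity of `f` contains a nonempty open subset of `Sⁿ`, then `f` is not surjective. -/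
theorem sphere_map_not_surjective_of_open_injectivity
    (n : ℕ) (hn : 1 ≤ n)
    (f : (Metric.sphere (0 : EuclideanSpace ℝ (Fin (n + 1))) 1) →
         (Metric.sphere (0 : EuclideanSpace ℝ (Fin (n + 2))) 1))
    (hf : Continuous f)
    (U : Set (Metric.sphere (0 : EuclideanSpace ℝ (Fin (n + 1))) 1))
    (hUopen : IsOpen U) (hUne : U.Nonempty)
    (hUinj : ∀ p ∈ U, ∀ q, f q = f p → q = p) :
    ¬ Function.Surjective f := by
  intro hsurj
  obtain ⟨p, hp⟩ := hUne
  have hopen : ∀ W ⊆ U, IsOpen W → IsOpen (f '' W) := by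
    intro W hWU hW
    have : f '' W = (f '' Wᶜ)ᶜ := by
      ext y
      constructor
      · rintro ⟨x, hx, rfl⟩ ⟨z, hz, hzx⟩
        exact hz (hUinj x (hWU hx) z hzx ▸ hx)
      · intro hy
        obtain ⟨x, rfl⟩ := hsurj y
        by_contra h
        exact hy ⟨x, fun hx => h ⟨x, hx, rfl⟩, rfl⟩
    rw [this, isOpen_compl_iff]
    exact (hW.isClosed_compl.isCompact.image hf).isClosed
  let c := chartAt (EuclideanSpace ℝ (Fin n)) p
  let d := chartAt (EuclideanSpace ℝ (Fin (n + 1))) (f p)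
  let σ := Function.surjInv hsurj
  have hσ : ∀ y, f (σ y) = y := Function.surjInv_eq hsurj
  have hσf : ∀ x ∈ U, σ (f x) = x := fun x hx => hUinj x hx _ (hσ _)
  let W := U ∩ c.source
  have hWopen : IsOpen W := hUopen.inter c.open_source
  have hσW : MapsTo σ (f '' W) W := by
    rintro _ ⟨x, hx, rfl⟩
    rwa [hσf x hx.1]
  have hσcont : ContinuousOn σ (f '' W) := by
    refine continuousOn_iff_continuous_domRestrict.2 (continuous_def.2 fun T hT => ?_)
    refine ⟨f '' (W ∩ T), hopen _ (inter_subset_left.trans inter_subset_left)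
      (hWopen.inter hT), ?_⟩
    ext ⟨_, x, hx, rfl⟩
    constructor
    · rintro ⟨z, hz, hzx⟩
      obtain rfl := hUinj x hx.1 z hzx
      simpa [hσf z hx.1] using hz.2
    · intro h
      exact ⟨x, ⟨hx, by simpa [hσf x hx.1] using h⟩, rfl⟩
  refine IsOpen.not_injOn_of_finrank_lt (E := EuclideanSpace ℝ (Fin (n + 1)))
    (F := EuclideanSpace ℝ (Fin n)) (by simp) (g := fun y => c (σ (d.symm y)))
    (V := d.target ∩ d.symm ⁻¹' (f '' W))
    (d.isOpen_inter_preimage_symm (hopen W inter_subset_left hWopen))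
    ⟨d (f p), d.map_source (mem_chart_source _ _), ?_⟩ ?_ ?_
  · rw [mem_preimage, d.left_inv (mem_chart_source _ _)]
    exact ⟨p, ⟨hp, mem_chart_source _ _⟩, rfl⟩
  · exact c.continuousOn.comp
      (hσcont.comp (d.continuousOn_symm.mono inter_subset_left) fun y hy => hy.2)
      fun y hy => (hσW hy.2).2
  · intro y hy z hz hyz
    have h1 := c.injOn (hσW hy.2).2 (hσW hz.2).2 hyz
    have h2 : d.symm y = d.symm z := by rw [← hσ (d.symm y), h1, hσ]
    exact d.symm.injOn hy.1 hz.1 h2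
end

section
/- Let n ≥ 1 and let f : S^n → S^{n+1} be a continuous map. If the set of injectivity I of f contains a nonempty open subset of S^n, then f(S^n) separates S^{n+1}: the complement S^{n+1} \ f(S^n) is nonempty and is not a connected set (it has at least two connected components). -/
open Set Filter Topology MeasureTheory Metric

section Retraction

variable {E : Type*} [NormedAddCommGroup E] [InnerProductSpace ℝ E] [FiniteDimensional ℝ E]

/-- A linear endomorphism without kernel has nonzero determinant. -/
theorem ContinuousLinearMap.det_ne_zero_of_forall_ne_zero (A : E →L[ℝ] E)
    (h : ∀ v, A v = 0 → v = 0) : A.det ≠ 0 := by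
  intro h0
  obtain ⟨v, hv, hv0⟩ := (Submodule.ne_bot_iff _).1 (LinearMap.bot_lt_ker_of_det_eq_zero h0).ne'
  exact hv0 (h v hv)

theorem ContinuousLinearMap.surjective_of_det_ne_zero (A : E →L[ℝ] E) (h : A.det ≠ 0) :
    Function.Surjective A :=
  (A.toContinuousLinearEquivOfDetNeZero h).surjective

/-- The derivative of a map of constant nonzero norm is singular. -/
theorem det_fderiv_eq_zero_of_norm_const {r : E → E} {R : ℝ} (hR : 0 < R) (h : ∀ x, ‖r x‖ = R)
    {x : E} (hd : DifferentiableAt ℝ r x) : (fderiv ℝ r x).det = 0 := by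
  by_contra h0
  obtain ⟨v, hv⟩ := (fderiv ℝ r x).surjective_of_det_ne_zero h0 (r x)
  have h1 := hd.hasFDerivAt.norm_sq
  have h2 : (fun y => ‖r y‖ ^ 2) = fun _ => R ^ 2 := by ext y; rw [h y]
  rw [h2] at h1
  have h3 := congrArg (fun L => L v) (h1.unique (hasFDerivAt_const (R ^ 2) x))
  simp [hv, h x] at h3
  exact hR.ne' h3

/-- The determinant of `1 + t A` is a polynomial in `t` of degree at most `dim E`. -/
theorem exists_polynomial_det_one_add_smul (A : E →L[ℝ] E) :
    ∃ p : Polynomial ℝ, p.natDegree ≤ Module.finrank ℝ E ∧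
      ∀ t : ℝ, (1 + t • A).det = p.eval t := by
  let b := Module.finBasis ℝ E
  let M := LinearMap.toMatrix b b (A : E →ₗ[ℝ] E)
  refine ⟨((Polynomial.X : Polynomial ℝ) • M.map Polynomial.C +
    (1 : Matrix _ _ ℝ).map Polynomial.C).det, ?_, fun t => ?_⟩
  · simpa using Polynomial.natDegree_det_X_add_C_le M 1
  · rw [ContinuousLinearMap.det, ← LinearMap.det_toMatrix b, ← Polynomial.coe_evalRingHom,
      RingHom.map_det]
    congr 1
    have : ((1 + t • A : E →L[ℝ] E) : E →ₗ[ℝ] E) = 1 + t • (A : E →ₗ[ℝ] E) := rfl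
    rw [this, map_add, map_smul, LinearMap.toMatrix_one]
    ext i j
    simp [M, add_comm, Matrix.one_apply]
    split_ifs <;> simp [mul_comm]

/-- Evaluation at `1` of polynomials of bounded degree is a combination of their values at finitely
many points of any given nontrivial interval. -/
theorem exists_eval_one_eq_sum (d : ℕ) {t₀ : ℝ} (ht₀ : 0 < t₀) :
    ∃ (s : Finset ℝ) (w : ℝ → ℝ), (∀ t ∈ s, t ∈ Ioo 0 t₀) ∧
      ∀ p : Polynomial ℝ, p.natDegree ≤ d → p.eval 1 = ∑ t ∈ s, w t * p.eval t := by
  obtain ⟨s, hs, hcard⟩ := (Ioo_infinite ht₀).exists_subset_card_eq (d + 1)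
  refine ⟨s, fun t => (Lagrange.basis s id t).eval 1, fun t ht => hs ht, fun p hp => ?_⟩
  have hdeg : p.degree < s.card := by
    rw [hcard]
    exact (Polynomial.degree_le_of_natDegree_le hp).trans_lt (by exact_mod_cast Nat.lt_succ_self d)
  conv_lhs => rw [Lagrange.eq_interpolate (v := id) Function.injective_id.injOn hdeg]
  rw [Lagrange.interpolate_apply, Polynomial.eval_finsetSum]
  simp [mul_comm]

/-- A small perturbation of the identity by a Lipschitz map fixing the sphere has positive Jacobian
determinant. -/
theorem det_one_add_smul_pos {A : E →L[ℝ] E} {K t : ℝ} (hA : ‖A‖ ≤ K) (ht : 0 ≤ t)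
    (htK : t * K < 1) : 0 < (1 + t • A).det := by
  have hne : ∀ s ∈ Icc 0 t, (1 + s • A).det ≠ 0 := by
    intro s hs
    apply ContinuousLinearMap.det_ne_zero_of_forall_ne_zero
    intro v hv
    by_contra hv0
    have h1 : v = -(s • A v) := by
      rw [eq_neg_iff_add_eq_zero]; simpa using hv
    have h2 : ‖v‖ ≤ t * K * ‖v‖ := by
      calc ‖v‖ = s * ‖A v‖ := by
            conv_lhs => rw [h1]
            rw [norm_neg, norm_smul, Real.norm_of_nonneg hs.1]
        _ ≤ t * (K * ‖v‖) := by
            gcongr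
            · exact hs.2
            · exact A.le_of_opNorm_le hA v
        _ = _ := by ring
    nlinarith [norm_pos_iff.2 hv0]
  have hc : ContinuousOn (fun s : ℝ => (1 + s • A).det) (Icc 0 t) :=
    (ContinuousLinearMap.continuous_det.comp (by fun_prop)).continuousOn
  by_contra hneg
  have h0 : (1 + (0 : ℝ) • A).det = 1 := by simp [ContinuousLinearMap.det]
  obtain ⟨s, hs, hs0⟩ := intermediate_value_Icc' ht hc (show (0 : ℝ) ∈ _ from
    ⟨not_lt.1 hneg, by simp only [h0]; norm_num⟩)
  exact hne s hs hs0

/-- No-retraction theorem, smooth version. -/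
theorem not_exists_contDiff_retraction {R : ℝ} (hR : 0 < R) (r : E → E) (hr : ContDiff ℝ 1 r)
    (hnorm : ∀ x, ‖r x‖ = R) (hfix : ∀ x, ‖x‖ = R → r x = x) : False := by
  borelize E
  let D : E → E →L[ℝ] E := fun x => fderiv ℝ r x - 1
  have hDc : Continuous D := (hr.continuous_fderiv one_ne_zero).sub continuous_const
  have hg : ∀ x, HasFDerivAt (fun y => r y - y) (D x) x := fun x =>
    ((hr.differentiable one_ne_zero x).hasFDerivAt).sub (hasFDerivAt_id x)
  obtain ⟨K, hK⟩ := ((isCompact_closedBall (0 : E) R).image hDc.norm).bddAbove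
  have hDK : ∀ x ∈ closedBall (0 : E) R, ‖D x‖ ≤ K := fun x hx => hK ⟨x, hx, rfl⟩
  have hK0 : 0 ≤ K := (norm_nonneg _).trans (hDK 0 (by simp [hR.le]))
  have hLip : ∀ x ∈ closedBall (0 : E) R, ∀ y ∈ closedBall (0 : E) R,
      ‖(r y - y) - (r x - x)‖ ≤ K * ‖y - x‖ := fun x hx y hy =>
    (convex_closedBall (0 : E) R).norm_image_sub_le_of_norm_hasFDerivWithin_le
      (fun z _ => (hg z).hasFDerivWithinAt) hDK hx hy
  set t₀ : ℝ := 1 / (K + 1) with ht₀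
  have ht₀pos : 0 < t₀ := by positivity
  have hsmall : ∀ t ∈ Ioo 0 t₀, t * K < 1 ∧ t < 1 := by
    intro t ht
    have h1 : t * (K + 1) < 1 := by
      have := ht.2
      rwa [ht₀, lt_div_iff₀ (by positivity)] at this
    constructor <;> nlinarith [ht.1, mul_nonneg ht.1.le hK0]
  -- the volume of the ball is the integral of the Jacobian for small times
  have key : ∀ t ∈ Ioo 0 t₀,
      ∫ x in ball (0 : E) R, (1 + t • D x).det = (volume : Measure E).real (ball (0 : E) R) := by
    intro t ht
    obtain ⟨htK, ht1⟩ := hsmall t ht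
    let f : E → E := fun x => x + t • (r x - x)
    have hf : ∀ x, HasFDerivAt f (1 + t • D x) x := fun x =>
      (hasFDerivAt_id x).add ((hg x).const_smul t)
    have hfs : ∀ x, HasStrictFDerivAt f (1 + t • D x) x := by
      intro x
      have hfc : ContDiff ℝ 1 f := by fun_prop
      exact hfc.contDiffAt.hasStrictFDerivAt' (hf x) one_ne_zero
    have hdet : ∀ x ∈ closedBall (0 : E) R, 0 < (1 + t • D x).det := fun x hx =>
      det_one_add_smul_pos (hDK x hx) ht.1.le htK
    have hinj : InjOn f (closedBall (0 : E) R) := by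
      intro x hx y hy hxy
      by_contra hne
      have h1 : y - x = -(t • ((r y - y) - (r x - x))) := by
        have : x + t • (r x - x) = y + t • (r y - y) := hxy
        rw [smul_sub, eq_neg_iff_add_eq_zero]
        have h2 : y + t • (r y - y) - (x + t • (r x - x)) = 0 := by rw [this, sub_self]
        rw [← h2]; abel
      have h2 : ‖y - x‖ ≤ t * (K * ‖y - x‖) := by
        conv_lhs => rw [h1]
        rw [norm_neg, norm_smul, Real.norm_of_nonneg ht.1.le]
        exact mul_le_mul_of_nonneg_left (hLip x hx y hy) ht.1.le
      nlinarith [norm_pos_iff.2 (sub_ne_zero.2 (Ne.symm hne))]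
    have hmaps : ∀ x ∈ ball (0 : E) R, f x ∈ ball (0 : E) R := by
      intro x hx
      rw [mem_ball_zero_iff] at hx ⊢
      have h1 : f x = (1 - t) • x + t • r x := by simp only [f]; module
      calc ‖f x‖ ≤ (1 - t) * ‖x‖ + t * R := by
            rw [h1]
            refine (norm_add_le _ _).trans ?_
            rw [norm_smul, norm_smul, hnorm, Real.norm_of_nonneg ht.1.le,
              Real.norm_of_nonneg (by linarith)]
        _ < R := by nlinarith
    have hsph : ∀ x, ‖x‖ = R → f x = x := fun x hx => by simp [f, hfix x hx]
    have himage : f '' ball (0 : E) R = ball (0 : E) R := by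
      have hopen : IsOpen (f '' ball (0 : E) R) := by
        rw [isOpen_iff_mem_nhds]
        rintro _ ⟨x, hx, rfl⟩
        rw [← (hfs x).map_nhds_eq_of_surj (LinearMap.range_eq_top.2
          ((1 + t • D x).surjective_of_det_ne_zero (hdet x (ball_subset_closedBall hx)).ne'))]
        exact image_mem_map (isOpen_ball.mem_nhds hx)
      have hclosed : IsClosed (f '' closedBall (0 : E) R) :=
        ((isCompact_closedBall (0 : E) R).image
          (by have := hr.continuous; fun_prop)).isClosed
      refine subset_antisymm (image_subset_iff.2 hmaps) ?_
      refine ((convex_ball (0 : E) R).isPreconnected).subset_of_closure_inter_subset hopen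
        ⟨f 0, hmaps 0 (by simp [hR]), 0, by simp [hR], rfl⟩ ?_
      rintro y ⟨hy, hyb⟩
      obtain ⟨x, hx, rfl⟩ := closure_minimal (image_mono ball_subset_closedBall) hclosed hy
      refine ⟨x, ?_, rfl⟩
      rw [mem_closedBall_zero_iff] at hx
      rw [mem_ball_zero_iff]
      refine lt_of_le_of_ne hx fun hxR => ?_
      rw [hsph x hxR, mem_ball_zero_iff] at hyb
      exact hyb.ne hxR
    have hcv := integral_image_eq_integral_abs_det_fderiv_smul (volume : Measure E)
      (measurableSet_ball (x := (0 : E)) (ε := R)) (fun x _ => (hf x).hasFDerivWithinAt)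
      (hinj.mono ball_subset_closedBall) (fun _ => (1 : ℝ))
    rw [himage] at hcv
    simp only [integral_const, smul_eq_mul, mul_one, measureReal_restrict_apply_univ] at hcv
    rw [hcv]
    refine setIntegral_congr_fun measurableSet_ball fun x hx => ?_
    exact (abs_of_pos (hdet x (ball_subset_closedBall hx))).symm
  have hint : ∀ t : ℝ, IntegrableOn (fun x => (1 + t • D x).det) (ball (0 : E) R) := fun t =>
    ((ContinuousLinearMap.continuous_det.comp (by fun_prop :
      Continuous fun x => 1 + t • D x)).continuousOn.integrableOn_compact
      (isCompact_closedBall (0 : E) R)).mono_set ball_subset_closedBall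
  obtain ⟨s, w, hs, hw⟩ := exists_eval_one_eq_sum (Module.finrank ℝ E) ht₀pos
  have hdet : ∀ x, (1 + (1 : ℝ) • D x).det = ∑ t ∈ s, w t * (1 + t • D x).det := by
    intro x
    obtain ⟨p, hp, hpe⟩ := exists_polynomial_det_one_add_smul (D x)
    simp only [hpe]
    exact hw p hp
  have hone : ∑ t ∈ s, w t = 1 := by simpa using (hw 1 (by simp)).symm
  have hzero : ∀ x, (1 + (1 : ℝ) • D x).det = 0 := by
    intro x
    have : 1 + (1 : ℝ) • D x = fderiv ℝ r x := by simp [D]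
    rw [this]
    exact det_fderiv_eq_zero_of_norm_const hR hnorm (hr.differentiable one_ne_zero x)
  have hvol : (volume : Measure E).real (ball (0 : E) R) = 0 := by
    calc (volume : Measure E).real (ball (0 : E) R)
        = ∑ t ∈ s, w t * ∫ x in ball (0 : E) R, (1 + t • D x).det := by
          rw [Finset.sum_congr rfl fun t ht => by rw [key t (hs t ht)], ← Finset.sum_mul, hone,
            one_mul]
      _ = ∫ x in ball (0 : E) R, ∑ t ∈ s, w t * (1 + t • D x).det := by
          rw [integral_finsetSum _ fun t _ => (hint t).const_mul (w t)]
          simp only [integral_const_mul]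
      _ = 0 := by simp only [← hdet, hzero, integral_zero]
  exact (ENNReal.toReal_pos (measure_ball_pos (volume : Measure E) 0 hR).ne'
    measure_ball_lt_top.ne).ne' hvol

/-- A continuous self-map which does not vanish on the unit ball and is never opposite to the
identity on the unit sphere does not exist. -/
theorem not_exists_nonvanishing_of_segment {F : E → E} (hF : Continuous F)
    (hne : ∀ x, ‖x‖ ≤ 1 → F x ≠ 0)
    (hseg : ∀ x, ‖x‖ = 1 → ∀ t ∈ Icc (0 : ℝ) 1, (1 - t) • x + t • F x ≠ 0) : False := by
  let ρ : E → E := fun x => (max 1 ‖x‖)⁻¹ • x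
  let τ : E → ℝ := fun x => min 1 (max 0 (2 - ‖x‖))
  let H : E → E := fun x => (1 - τ x) • ρ x + τ x • F (ρ x)
  have hmax : ∀ x : E, max 1 ‖x‖ ≠ 0 := fun x => (lt_max_of_lt_left one_pos).ne'
  have hρ : Continuous ρ := ((continuous_const.max continuous_norm).inv₀ hmax).smul continuous_id
  have hH : Continuous H := by fun_prop
  have hH2 : ∀ x, 2 ≤ ‖x‖ → H x = ‖x‖⁻¹ • x := by
    intro x hx
    have h1 : τ x = 0 := by
      simp only [τ]; rw [max_eq_left (by linarith), min_eq_right zero_le_one]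
    simp only [H, h1, ρ]
    rw [max_eq_right (by linarith)]
    simp
  have hH0 : ∀ x, H x ≠ 0 := by
    intro x
    rcases le_total ‖x‖ 1 with hx | hx
    · have h1 : τ x = 1 := by
        simp only [τ]; rw [max_eq_right (by linarith), min_eq_left (by linarith)]
      have h2 : ρ x = x := by simp [ρ, max_eq_left hx]
      simpa [H, h1, h2] using hne x hx
    · refine hseg (ρ x) ?_ (τ x) ⟨le_min zero_le_one (le_max_left _ _), min_le_left _ _⟩
      simp only [ρ, max_eq_right hx]
      rw [norm_smul, norm_inv, norm_norm, inv_mul_cancel₀ (by linarith)]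
  let ν : E → E := fun x => ‖H x‖⁻¹ • H x
  have hν : Continuous ν := (hH.norm.inv₀ fun x => norm_ne_zero_iff.2 (hH0 x)).smul hH
  have hν1 : ∀ x, ‖ν x‖ = 1 := fun x => by
    simp only [ν]
    rw [norm_smul, norm_inv, norm_norm, inv_mul_cancel₀ (norm_ne_zero_iff.2 (hH0 x))]
  have hν2 : ∀ x, 2 ≤ ‖x‖ → ν x = ‖x‖⁻¹ • x := by
    intro x hx
    simp only [ν, hH2 x hx]
    rw [norm_smul, norm_inv, norm_norm, inv_mul_cancel₀ (by linarith)]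
    simp
  have hU : IsOpen {x : E | 2 < ‖x‖} := isOpen_lt continuous_const continuous_norm
  have hS : IsClosed {x : E | 3 ≤ ‖x‖} := isClosed_le continuous_const continuous_norm
  have hνs : ContDiffOn ℝ 1 ν {x : E | 2 < ‖x‖} := by
    have : ContDiffOn ℝ 1 (fun x : E => ‖x‖⁻¹ • x) {x : E | 2 < ‖x‖} := by
      intro x hx
      have hx0 : x ≠ 0 := norm_pos_iff.1 (lt_trans two_pos hx)
      exact (((contDiffAt_norm ℝ hx0).inv (norm_ne_zero_iff.2 hx0)).smul
        contDiffAt_id).contDiffWithinAt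
    exact this.congr fun x hx => hν2 x (le_of_lt hx)
  obtain ⟨g, hg, hgν, hgS, -⟩ := hν.exists_contDiff_approx_and_eqOn 1
    (continuous_const (y := (1 / 2 : ℝ))) (fun _ => by norm_num) hS
    (hU.mem_nhdsSet.2 fun x (hx : 3 ≤ ‖x‖) => show 2 < ‖x‖ by linarith) hνs
  have hg0 : ∀ x, g x ≠ 0 := by
    intro x hx
    have := hgν x
    rw [hx, dist_zero_left, hν1] at this
    norm_num at this
  refine not_exists_contDiff_retraction (R := 3) (by norm_num) (fun x => (3 * ‖g x‖⁻¹) • g x)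
    ?_ (fun x => ?_) fun x hx => ?_
  · refine contDiff_iff_contDiffAt.2 fun x => ?_
    have hgx := hg.contDiffAt (x := x)
    exact (contDiffAt_const.mul ((hgx.norm ℝ (hg0 x)).inv (norm_ne_zero_iff.2 (hg0 x)))).smul hgx
  · rw [norm_smul, norm_mul, norm_inv, norm_norm, mul_assoc,
      inv_mul_cancel₀ (norm_ne_zero_iff.2 (hg0 x))]
    norm_num
  · have h1 : g x = (3 : ℝ)⁻¹ • x := by
      rw [hgS (show 3 ≤ ‖x‖ from hx.ge), hν2 x (by linarith), hx]
    rw [h1, norm_smul, hx, smul_smul]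
    norm_num

end Retraction

section Zeros

variable {E : Type*} [NormedAddCommGroup E]

/-- The zeros of `G` are finitely many in every bounded region. -/
def HasLocallyFiniteZeros (G : E → E) : Prop :=
  ∀ R : ℝ, ({x | G x = 0} ∩ closedBall 0 R).Finite

theorem HasLocallyFiniteZeros.exists_sphere_forall_ne_zero {G : E → E}
    (hG : HasLocallyFiniteZeros G) (a : E) {r₁ r₂ : ℝ} (hr : r₁ < r₂) :
    ∃ r ∈ Ioo r₁ r₂, ∀ z, dist z a = r → G z ≠ 0 := by
  obtain ⟨r, hr, hrn⟩ := (Ioo_infinite hr).exists_notMem_finite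
    ((hG (r₂ + ‖a‖)).image fun z => dist z a)
  refine ⟨r, hr, fun z hz hz0 => hrn ⟨z, ⟨hz0, ?_⟩, hz⟩⟩
  rw [mem_closedBall_zero_iff]
  have h1 : dist z 0 ≤ dist z a + dist a 0 := dist_triangle z a 0
  rw [dist_zero_right, dist_zero_right] at h1
  linarith [hr.2]

/-- The point `x` can be removed from the zero set within the ball of radius `R`, by modifications
which do not affect the values on `C` and create no new zero in that ball. -/
def IsEscapable (C : Set E) (R : ℝ) (x : E) : Prop :=
  ∀ G : E → E, Continuous G → HasLocallyFiniteZeros G → ∃ G' : E → E, Continuous G' ∧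
    HasLocallyFiniteZeros G' ∧ EqOn G' G C ∧ ∀ z, ‖z‖ ≤ R → G' z = 0 → G z = 0 ∧ z ≠ x

theorem isEscapable_of_lt_norm {C : Set E} {R : ℝ} {x : E} (hx : R < ‖x‖) :
    IsEscapable C R x :=
  fun G hG hGz => ⟨G, hG, hGz, fun _ _ => rfl, fun _ hzR hz =>
    ⟨hz, fun h => (h ▸ hzR).not_gt hx⟩⟩

/-- If all points off `C` are escapable, then all zeros can be removed from a ball. -/
theorem exists_eqOn_forall_ne_zero {C : Set E} {R : ℝ} (hesc : ∀ x, x ∉ C → IsEscapable C R x)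
    {G : E → E} (hG : Continuous G) (hGz : HasLocallyFiniteZeros G) (hGC : ∀ x ∈ C, G x ≠ 0) :
    ∃ G' : E → E, Continuous G' ∧ EqOn G' G C ∧ ∀ z, ‖z‖ ≤ R → G' z ≠ 0 := by
  induction hk : ({x | G x = 0} ∩ closedBall 0 R).ncard using Nat.strong_induction_on
    generalizing G with
  | _ k ih =>
    by_cases hx : ∃ x, ‖x‖ ≤ R ∧ G x = 0
    · obtain ⟨x, hxR, hx0⟩ := hx
      obtain ⟨G₁, hG₁, hG₁z, hEq₁, hzero₁⟩ := hesc x (fun h => hGC x h hx0) G hG hGz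
      have hlt : ({x | G₁ x = 0} ∩ closedBall 0 R).ncard < k := by
        rw [← hk]
        refine ncard_lt_ncard ⟨?_, fun h => ?_⟩ (hGz R)
        · rintro z ⟨hz, hzR⟩
          exact ⟨(hzero₁ z (mem_closedBall_zero_iff.1 hzR) hz).1, hzR⟩
        · have h1 : x ∈ {x | G₁ x = 0} ∩ closedBall 0 R :=
            h ⟨hx0, mem_closedBall_zero_iff.2 hxR⟩
          exact (hzero₁ x hxR h1.1).2 rfl
      obtain ⟨G', hG', hEq', hne'⟩ :=
        ih _ hlt hG₁ hG₁z (fun z hz => by rw [hEq₁ hz]; exact hGC z hz) rfl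
      exact ⟨G', hG', hEq'.trans hEq₁, hne'⟩
    · push Not at hx
      exact ⟨G, hG, fun _ _ => rfl, hx⟩

variable [InnerProductSpace ℝ E] [FiniteDimensional ℝ E]

/-- The zeros of a map inside a ball can be collapsed to the centre of the ball, without changing
the map outside the ball. -/
theorem HasLocallyFiniteZeros.exists_collapse {G : E → E} (hG : Continuous G)
    (hGz : HasLocallyFiniteZeros G) {a : E} {r : ℝ} (hr : 0 < r)
    (hs : ∀ z, dist z a = r → G z ≠ 0) :
    ∃ G' : E → E, Continuous G' ∧ HasLocallyFiniteZeros G' ∧ EqOn G' G (ball a r)ᶜ ∧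
      ∀ z, G' z = 0 → z = a ∨ (z ∉ ball a r ∧ G z = 0) := by
  let m : E → ℝ := fun z => min 1 (‖z - a‖ / r)
  let G' : E → E := fun z => m z • G (a + (m z)⁻¹ • (z - a))
  have hm : Continuous m := by fun_prop
  have hm0 : ∀ z, z ≠ a → m z ≠ 0 := fun z hz =>
    (lt_min one_pos (div_pos (norm_pos_iff.2 (sub_ne_zero.2 hz)) hr)).ne'
  have hout : ∀ z, z ∉ ball a r → m z = 1 := by
    intro z hz
    rw [mem_ball, dist_eq_norm, not_lt] at hz
    exact min_eq_left ((one_le_div hr).2 hz)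
  have hin : ∀ z, z ∈ ball a r → m z = ‖z - a‖ / r := by
    intro z hz
    rw [mem_ball, dist_eq_norm] at hz
    exact min_eq_right ((div_le_one hr).2 hz.le)
  have hproj : ∀ z, z ∈ ball a r → z ≠ a → dist (a + (m z)⁻¹ • (z - a)) a = r := by
    intro z hz hza
    have hpos : ‖z - a‖ ≠ 0 := norm_ne_zero_iff.2 (sub_ne_zero.2 hza)
    rw [hin z hz, dist_eq_norm, add_sub_cancel_left, norm_smul, norm_inv, norm_div, norm_norm,
      Real.norm_of_nonneg hr.le]
    field_simp
  have hEq : EqOn G' G (ball a r)ᶜ := by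
    intro z hz
    simp [G', hout z hz]
  have hzero : ∀ z, G' z = 0 → z = a ∨ (z ∉ ball a r ∧ G z = 0) := by
    intro z hz
    by_cases hza : z = a
    · exact Or.inl hza
    · right
      by_cases hzb : z ∈ ball a r
      · exact absurd ((smul_eq_zero.1 hz).resolve_left (hm0 z hza)) (hs _ (hproj z hzb hza))
      · exact ⟨hzb, by rw [← hEq hzb, hz]⟩
  refine ⟨G', ?_, ?_, hEq, hzero⟩
  · refine continuous_iff_continuousAt.2 fun z => ?_
    by_cases hza : z = a
    · subst hza
      obtain ⟨M, hM⟩ := ((isCompact_closedBall z r).image hG.norm).bddAbove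
      have hGz0 : G' z = 0 := by simp [G', m]
      rw [ContinuousAt, hGz0]
      have hlim : Tendsto (fun y => m y * M) (𝓝 z) (𝓝 0) := by
        have h1 : Continuous fun y => m y * M := by fun_prop
        have h2 := h1.tendsto z
        simpa [m] using h2
      refine squeeze_zero_norm' ?_ hlim
      filter_upwards [ball_mem_nhds z hr] with y hy
      have hm_nonneg : 0 ≤ m y := le_min zero_le_one (by positivity)
      simp only [G']
      rw [norm_smul, Real.norm_of_nonneg hm_nonneg]
      refine mul_le_mul_of_nonneg_left (hM ⟨_, ?_, rfl⟩) hm_nonneg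
      by_cases hyz : y = z
      · subst hyz
        simp [hr.le]
      · exact (hproj y hy hyz).le
    · have h1 : ContinuousAt (fun y => a + (m y)⁻¹ • (y - a)) z :=
        continuousAt_const.add ((hm.continuousAt.inv₀ (hm0 z hza)).smul
          (continuousAt_id.sub continuousAt_const))
      exact hm.continuousAt.smul (hG.continuousAt.comp h1)
  · intro R
    refine ((finite_singleton a).union (hGz R)).subset ?_
    rintro z ⟨hz, hzR⟩
    rcases hzero z hz with h | h
    · exact Or.inl h
    · exact Or.inr ⟨h.2, hzR⟩

/-- Every continuous self-map can be approximated by one with locally finitely many zeros. -/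
theorem exists_approx_hasLocallyFiniteZeros {G : E → E} (hG : Continuous G) {ε : ℝ}
    (hε : 0 < ε) :
    ∃ G' : E → E, Continuous G' ∧ HasLocallyFiniteZeros G' ∧ ∀ x, dist (G' x) (G x) < ε := by
  borelize E
  obtain ⟨g, hg, hgG, -⟩ := hG.exists_contDiff_approx 1
    (continuous_const (y := ε / 2)) (fun _ => by positivity)
  have hdiff : Differentiable ℝ g := hg.differentiable one_ne_zero
  have hnull : (volume : Measure E) (g '' {x | (fderiv ℝ g x).det = 0}) = 0 :=
    addHaar_image_eq_zero_of_det_fderivWithin_eq_zero volume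
      (fun x _ => (hdiff x).hasFDerivAt.hasFDerivWithinAt) fun x hx => hx
  obtain ⟨c, hcb, hc⟩ : ∃ c ∈ ball (0 : E) (ε / 2),
      c ∉ g '' {x | (fderiv ℝ g x).det = 0} := by
    by_contra! h
    exact (measure_ball_pos (volume : Measure E) 0 (half_pos hε)).ne'
      (measure_mono_null h hnull)
  refine ⟨fun x => g x - c, by have := hg.continuous; fun_prop, fun R => ?_, fun x => ?_⟩
  · have hclosed : IsClosed {x | g x - c = 0} :=
      isClosed_eq (by have := hg.continuous; fun_prop) continuous_const
    refine ((isCompact_closedBall (0 : E) R).inter_left hclosed).finite ?_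
    refine isDiscrete_iff_discreteTopology.2 (discreteTopology_subtype_iff.2 ?_)
    rintro x ⟨hx, -⟩
    have hdet : (fderiv ℝ g x).det ≠ 0 := fun h0 =>
      hc ⟨x, h0, sub_eq_zero.1 hx⟩
    have hd : HasFDerivAt g
        (((fderiv ℝ g x).toContinuousLinearEquivOfDetNeZero hdet : E ≃L[ℝ] E) : E →L[ℝ] E) x :=
      (hdiff x).hasFDerivAt
    have hev : ∀ᶠ z in 𝓝[≠] x, g z ≠ c := hd.eventually_ne ⟨_, ContinuousLinearEquiv.antilipschitz _⟩
    rw [← disjoint_iff, disjoint_principal_right]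
    filter_upwards [hev] with z hz hz'
    exact hz (sub_eq_zero.1 hz'.1)
  · rw [mem_ball_zero_iff] at hcb
    calc dist (g x - c) (G x) ≤ dist (g x - c) (g x) + dist (g x) (G x) := dist_triangle _ _ _
      _ < ε / 2 + ε / 2 := by
        refine add_lt_add ?_ (hgG x)
        simpa [dist_eq_norm] using hcb
      _ = ε := add_halves ε

theorem IsEscapable.of_ball_subset {C : Set E} {R : ℝ} {a x : E} {r : ℝ}
    (ha : IsEscapable C R a) (hr : ball a r ⊆ Cᶜ) (hx : dist x a < r) : IsEscapable C R x := by
  intro G hG hGz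
  obtain ⟨s, hs, hsz⟩ := hGz.exists_sphere_forall_ne_zero a hx
  obtain ⟨G₁, hG₁, hG₁z, hEq₁, hzero₁⟩ :=
    hGz.exists_collapse hG (dist_nonneg.trans_lt hs.1) hsz
  obtain ⟨G₂, hG₂, hG₂z, hEq₂, hzero₂⟩ := ha G₁ hG₁ hG₁z
  refine ⟨G₂, hG₂, hG₂z, fun z hz => (hEq₂ hz).trans (hEq₁ fun hzb => ?_), fun z hzR hz => ?_⟩
  · exact hr (ball_subset_ball hs.2.le hzb) hz
  · obtain ⟨h1, h2⟩ := hzero₂ z hzR hz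
    obtain ⟨h3, h4⟩ := (hzero₁ z h1).resolve_left h2
    exact ⟨h4, fun h => h3 (h ▸ hs.1)⟩

theorem eventually_isEscapable_iff {C : Set E} (hC : IsClosed C) (R : ℝ) {x : E} (hx : x ∉ C) :
    ∀ᶠ y in 𝓝 x, IsEscapable C R y ↔ IsEscapable C R x := by
  obtain ⟨ε, hε, hball⟩ := Metric.isOpen_iff.1 hC.isOpen_compl x hx
  filter_upwards [ball_mem_nhds x (half_pos hε)] with y hy
  rw [mem_ball] at hy
  refine ⟨fun h => h.of_ball_subset (r := ε / 2) ((ball_subset_ball' ?_).trans hball) ?_,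
    fun h => h.of_ball_subset hball (hy.trans (half_lt_self hε))⟩
  · linarith
  · rwa [dist_comm]

theorem isOpen_setOf_isEscapable {C : Set E} (hC : IsClosed C) (R : ℝ) :
    IsOpen {x | x ∉ C ∧ IsEscapable C R x} := by
  refine isOpen_iff_eventually.2 fun x hx => ?_
  filter_upwards [hC.isOpen_compl.mem_nhds hx.1, eventually_isEscapable_iff hC R hx.1] with y hy h
  exact ⟨hy, h.2 hx.2⟩

theorem isOpen_setOf_not_isEscapable {C : Set E} (hC : IsClosed C) (R : ℝ) :
    IsOpen {x | x ∉ C ∧ ¬ IsEscapable C R x} := by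
  refine isOpen_iff_eventually.2 fun x hx => ?_
  filter_upwards [hC.isOpen_compl.mem_nhds hx.1, eventually_isEscapable_iff hC R hx.1] with y hy h
  exact ⟨hy, fun h' => hx.2 (h.1 h')⟩

/-- If the complement of a closed set in a one-point compactification of `E` is connected and
contains the point at infinity, then all points off the set are escapable. -/
theorem isEscapable_of_isPreconnected_compl {X : Type*} [TopologicalSpace X] [T2Space X] {ι : E → X}
    (hι : IsOpenEmbedding ι) {v : X} (hv : v ∉ range ι) (hrange : {v}ᶜ ⊆ range ι) {K : Set X}
    (hK : IsClosed K) (hvK : v ∉ K) (hconn : IsPreconnected Kᶜ) (R : ℝ) {x : E} (hx : ι x ∉ K) :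
    IsEscapable (ι ⁻¹' K) R x := by
  have hC : IsClosed (ι ⁻¹' K) := hK.preimage hι.continuous
  by_contra hne
  have hA : IsOpen (ι '' {x | x ∉ ι ⁻¹' K ∧ IsEscapable (ι ⁻¹' K) R x} ∪
      (ι '' closedBall 0 R)ᶜ) :=
    (hι.isOpenMap _ (isOpen_setOf_isEscapable hC R)).union
      ((isCompact_closedBall (0 : E) R).image hι.continuous).isClosed.isOpen_compl
  have hB : IsOpen (ι '' {x | x ∉ ι ⁻¹' K ∧ ¬ IsEscapable (ι ⁻¹' K) R x}) :=
    hι.isOpenMap _ (isOpen_setOf_not_isEscapable hC R)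
  have hcover : Kᶜ ⊆ (ι '' {x | x ∉ ι ⁻¹' K ∧ IsEscapable (ι ⁻¹' K) R x} ∪
      (ι '' closedBall 0 R)ᶜ) ∪ ι '' {x | x ∉ ι ⁻¹' K ∧ ¬ IsEscapable (ι ⁻¹' K) R x} := by
    intro y hy
    by_cases hyv : y = v
    · exact Or.inl (Or.inr fun h => hv (hyv ▸ image_subset_range _ _ h))
    · obtain ⟨w, rfl⟩ := hrange hyv
      by_cases hw : IsEscapable (ι ⁻¹' K) R w
      · exact Or.inl (Or.inl ⟨w, ⟨hy, hw⟩, rfl⟩)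
      · exact Or.inr ⟨w, ⟨hy, hw⟩, rfl⟩
  obtain ⟨y, hyK, hyA, z, ⟨hzK, hz⟩, rfl⟩ := hconn _ _ hA hB hcover
    ⟨v, hvK, Or.inr fun h => hv (image_subset_range _ _ h)⟩ ⟨ι x, hx, x, ⟨hx, hne⟩, rfl⟩
  rcases hyA with ⟨w, hw, hwz⟩ | h
  · exact hz (hι.injective hwz ▸ hw.2)
  · refine hz (isEscapable_of_lt_norm (not_le.1 fun hle => h ⟨z, ?_, rfl⟩))
    exact mem_closedBall_zero_iff.2 hle

end Zeros

section Sphere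

variable {E : Type*} [NormedAddCommGroup E] [InnerProductSpace ℝ E] [FiniteDimensional ℝ E]

/-- There is a self-map of the sphere, up to positive scaling homotopic to the identity, which
collapses the complement of a given nonempty open set to a point. -/
theorem exists_collapse_compl_of_isOpen {U : Set (sphere (0 : E) 1)} (hU : IsOpen U)
    (hne : U.Nonempty) :
    ∃ (c : sphere (0 : E) 1 → E) (w : E) (δ : ℝ), Continuous c ∧ 0 < δ ∧ (∀ x ∉ U, c x = w) ∧
      ∀ x : sphere (0 : E) 1, ∀ t ∈ Icc (0 : ℝ) 1, δ ≤ ‖(1 - t) • (x : E) + t • c x‖ := by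
  obtain ⟨p, hp⟩ := hne
  obtain ⟨μ, hμ0, hμ1, hμ⟩ := exists_continuous_zero_one_of_isClosed hU.isClosed_compl
    (isClosed_singleton (x := p)) (disjoint_singleton_right.2 fun h => h hp)
  let c : sphere (0 : E) 1 → E := fun x => μ x • (x : E) - (1 - μ x) • (p : E)
  have hc : Continuous c := by fun_prop
  have hne : ∀ x : sphere (0 : E) 1, ∀ t ∈ Icc (0 : ℝ) 1,
      (1 - t) • (x : E) + t • c x ≠ 0 := by
    intro x t ht h0
    have h1 : (1 - t + t * μ x) • (x : E) = (t * (1 - μ x)) • (p : E) := by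
      refine sub_eq_zero.1 (Eq.trans ?_ h0)
      simp only [c]
      module
    have ha : 0 ≤ 1 - t + t * μ x := by nlinarith [ht.1, ht.2, (hμ x).1]
    have hb : 0 ≤ t * (1 - μ x) := mul_nonneg ht.1 (by linarith [(hμ x).2])
    have h2 : 1 - t + t * μ x = t * (1 - μ x) := by
      have := congrArg norm h1
      rwa [norm_smul, norm_smul, Real.norm_of_nonneg ha, Real.norm_of_nonneg hb,
        norm_eq_of_mem_sphere, norm_eq_of_mem_sphere, mul_one, mul_one] at this
    have h3 : x = p := by
      rw [h2] at h1
      exact Subtype.ext (smul_right_injective E (by linarith : t * (1 - μ x) ≠ 0) h1)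
    have h4 : μ x = 1 := hμ1 h3
    rw [h4] at h2
    linarith
  have hcpt : IsCompact (univ ×ˢ Icc 0 1 : Set (sphere (0 : E) 1 × ℝ)) :=
    isCompact_univ.prod isCompact_Icc
  have hcont : Continuous fun y : sphere (0 : E) 1 × ℝ =>
      ‖(1 - y.2) • (y.1 : E) + y.2 • c y.1‖ := by fun_prop
  obtain ⟨y, hy, hmin⟩ := hcpt.exists_isMinOn ⟨(p, 0), by simp⟩ hcont.continuousOn
  refine ⟨c, -p, _, hc, norm_pos_iff.2 (hne y.1 y.2 hy.2), fun x hx => ?_,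
    fun x t ht => hmin (show (x, t) ∈ (univ ×ˢ Icc 0 1 : Set (sphere (0 : E) 1 × ℝ)) from
       ⟨mem_univ _, ht⟩)⟩
  have h : μ x = 0 := hμ0 hx
  simp [c, h]

/-- A map on the sphere which stays away from the antipodes of the identity cannot be approximated
by maps which extend to the ball without zeros. -/
theorem not_exists_nonvanishing_approx {c : sphere (0 : E) 1 → E} {δ : ℝ}
    (hδ : ∀ x : sphere (0 : E) 1, ∀ t ∈ Icc (0 : ℝ) 1, δ ≤ ‖(1 - t) • (x : E) + t • c x‖)
    {F : E → E}
    (hF : Continuous F) (hne : ∀ x, ‖x‖ ≤ 1 → F x ≠ 0)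
    (hdist : ∀ x : sphere (0 : E) 1, dist (F x) (c x) < δ) : False := by
  refine not_exists_nonvanishing_of_segment hF hne fun x hx t ht h0 => ?_
  let y : sphere (0 : E) 1 := ⟨x, mem_sphere_zero_iff_norm.2 hx⟩
  have h1 : (1 - t) • (y : E) + t • c y = t • (c y - F x) := by
    have h : (1 - t) • (y : E) + t • c y = ((1 - t) • x + t • F x) + t • (c y - F x) := by
      simp only [y]
      module
    rw [h, h0, zero_add]
  have h2 := hδ y t ht
  rw [h1, norm_smul, Real.norm_of_nonneg ht.1, ← dist_eq_norm, dist_comm] at h2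
  have h3 := hdist y
  nlinarith [ht.2, mul_le_mul_of_nonneg_right ht.2 (dist_nonneg (x := F x) (y := c y))]

/-- A map which is constant off a set on which `f` is injective extends along `f`. -/
theorem exists_continuousMap_comp_eq {S X : Type*} [TopologicalSpace S] [CompactSpace S]
    [TopologicalSpace X] [T2Space X] [NormalSpace X] {f : S → X} (hf : Continuous f) {U : Set S}
    (hU : ∀ p ∈ U, ∀ q, f q = f p → q = p) {c : S → E} (hc : Continuous c) {w : E}
    (hw : ∀ x ∉ U, c x = w) : ∃ Q : C(X, E), ∀ x, Q (f x) = c x := by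
  have hq : IsQuotientMap (rangeFactorization f) :=
    hf.rangeFactorization.isClosedMap.isQuotientMap hf.rangeFactorization
      rangeFactorization_surjective
  have hfac : Function.FactorsThrough c (rangeFactorization f) := by
    intro x y hxy
    have hxy' : f x = f y := congrArg Subtype.val hxy
    by_cases hx : x ∈ U
    · rw [hU x hx y hxy'.symm]
    · by_cases hy : y ∈ U
      · rw [hU y hy x hxy']
      · rw [hw x hx, hw y hy]
  obtain ⟨Q, hQ⟩ := ContinuousMap.exists_restrict_eq (isCompact_range hf).isClosed
    (hq.lift (f := ⟨_, hf.rangeFactorization⟩) ⟨c, hc⟩ hfac)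
  refine ⟨Q, fun x => ?_⟩
  have h1 := DFunLike.congr_fun hQ (rangeFactorization f x)
  have h2 := DFunLike.congr_fun
    (hq.lift_comp (f := ⟨_, hf.rangeFactorization⟩) ⟨c, hc⟩ hfac) x
  exact h1.trans h2

variable {E' : Type*} [NormedAddCommGroup E'] [InnerProductSpace ℝ E']

theorem norm_inv_norm_smul_sub_le {y u : E'} (hu : ‖u‖ = 1) (hy : y ≠ 0) :
    ‖‖y‖⁻¹ • y - u‖ ≤ 2 * ‖y - u‖ := by
  have h1 : ‖‖y‖⁻¹ • y - y‖ = |1 - ‖y‖| := by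
    have hy' : ‖y‖ ≠ 0 := norm_ne_zero_iff.2 hy
    have : ‖y‖⁻¹ • y - y = (‖y‖⁻¹ - 1) • y := by module
    rw [this, norm_smul, Real.norm_eq_abs, ← abs_norm y, ← abs_mul, abs_norm]
    congr 1
    field_simp
  have h2 : |1 - ‖y‖| ≤ ‖y - u‖ := by
    rw [← hu, norm_sub_rev]
    exact abs_norm_sub_norm_le u y
  calc ‖‖y‖⁻¹ • y - u‖ ≤ ‖‖y‖⁻¹ • y - y‖ + ‖y - u‖ := norm_sub_le_norm_sub_add_norm_sub _ _ _
    _ ≤ 2 * ‖y - u‖ := by rw [h1]; linarith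

variable [FiniteDimensional ℝ E']

/-- A map from a sphere to a sphere of larger dimension, followed by a nowhere vanishing map, can be
approximated by a map extending without zeros. -/
theorem exists_nonvanishing_approx_of_finrank_lt
    (hdim : Module.finrank ℝ E < Module.finrank ℝ E') {f : sphere (0 : E) 1 → sphere (0 : E') 1}
    (hf : Continuous f) (Q : C(sphere (0 : E') 1, E)) (hQ : ∀ y, Q y ≠ 0) {δ : ℝ} (hδ : 0 < δ) :
    ∃ F : E → E, Continuous F ∧ (∀ x, F x ≠ 0) ∧
      ∀ x : sphere (0 : E) 1, dist (F x) (Q (f x)) < δ := by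
  obtain ⟨η, hη, hQη⟩ := Metric.uniformContinuous_iff.1
    (CompactSpace.uniformContinuous_of_continuous Q.continuous) δ hδ
  obtain ⟨g, hg⟩ := ContinuousMap.exists_restrict_eq isClosed_sphere
    (⟨fun x => (f x : E'), by fun_prop⟩ : C(sphere (0 : E) 1, E'))
  obtain ⟨P, hP, hPg, -⟩ := g.continuous.exists_contDiff_approx 1
    (continuous_const (y := η / 4)) (fun _ => by positivity)
  obtain ⟨a, ha, haη⟩ := (hP.dense_compl_range_of_finrank_lt_finrank hdim).exists_dist_lt 0
    (show 0 < η / 4 by positivity)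
  have hne : ∀ x, P x - a ≠ 0 := fun x h => ha ⟨x, sub_eq_zero.1 h⟩
  have hPc : Continuous P := hP.continuous
  let N : E → sphere (0 : E') 1 := fun x => ⟨‖P x - a‖⁻¹ • (P x - a), by
    rw [mem_sphere_zero_iff_norm, norm_smul, norm_inv, norm_norm,
      inv_mul_cancel₀ (norm_ne_zero_iff.2 (hne x))]⟩
  have hN : Continuous N := by
    refine Continuous.subtype_mk ?_ _
    exact ((hPc.sub continuous_const).norm.inv₀ fun x => norm_ne_zero_iff.2 (hne x)).smul
      (hPc.sub continuous_const)
  refine ⟨fun x => Q (N x), by fun_prop, fun x => hQ _, fun x => hQη ?_⟩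
  have hgx : g x = f x := DFunLike.congr_fun hg x
  have h1 := hPg x
  rw [hgx, dist_eq_norm] at h1
  rw [dist_zero_left] at haη
  have h2 : ‖P x - a - f x‖ < η / 2 := by
    calc ‖P x - a - f x‖ = ‖(P x - f x) - a‖ := by congr 1; abel
      _ ≤ ‖P x - f x‖ + ‖a‖ := norm_sub_le _ _
      _ < η / 2 := by linarith
  rw [Subtype.dist_eq, dist_eq_norm]
  have h3 := norm_inv_norm_smul_sub_le (norm_eq_of_mem_sphere (f x)) (hne x)
  simp only [N]
  linarith

/-- If the complement of the image of `f` is connected and nonempty, then `f`, followed by a map not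
vanishing on its image, can be approximated by a map extending to the ball without zeros. -/
theorem exists_nonvanishing_approx_of_isPreconnected_compl {X : Type*} [TopologicalSpace X]
    [T2Space X] {ι : E → X} (hι : IsOpenEmbedding ι) {v : X} (hrange : range ι = {v}ᶜ)
    {f : sphere (0 : E) 1 → X} (hf : Continuous f) (hv : v ∉ range f)
    (hconn : IsPreconnected (range f)ᶜ) (Q : C(X, E)) {δ : ℝ} (hδ : 0 < δ)
    (hQ : ∀ x, δ ≤ ‖Q (f x)‖) :
    ∃ F : E → E, Continuous F ∧ (∀ x, ‖x‖ ≤ 1 → F x ≠ 0) ∧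
      ∀ x : sphere (0 : E) 1, dist (F x) (Q (f x)) < δ := by
  have hlift : ∀ x, ∃ y, ι y = f x := fun x => by
    have : f x ∈ range ι := by
      rw [hrange]
      exact fun h => hv ⟨x, h⟩
    exact this
  choose φ hφ using hlift
  have hφc : Continuous φ := by
    rw [hι.isInducing.continuous_iff]
    exact hf.congr fun x => (hφ x).symm
  obtain ⟨Φ, hΦ⟩ := ContinuousMap.exists_restrict_eq isClosed_sphere
    (⟨φ, hφc⟩ : C(sphere (0 : E) 1, E))
  obtain ⟨R, hR⟩ := ((isCompact_closedBall (0 : E) 1).image Φ.continuous.norm).bddAbove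
  obtain ⟨G, hG, hGz, hGQ⟩ := exists_approx_hasLocallyFiniteZeros
    (Q.continuous.comp hι.continuous) hδ
  obtain ⟨G', hG', hEq, hne⟩ := exists_eqOn_forall_ne_zero (C := ι ⁻¹' range f) (R := R)
    (fun x hx => isEscapable_of_isPreconnected_compl hι (v := v) (by simp [hrange]) hrange.ge
      (isCompact_range hf).isClosed hv hconn R hx) hG hGz (by
      rintro x ⟨s, hs⟩ hx
      have h1 := hGQ x
      rw [hx, dist_zero_left, Function.comp_apply, ← hs] at h1
      exact (hQ s).not_gt h1)
  refine ⟨fun x => G' (Φ x), by fun_prop, fun x hx => hne _ (hR ⟨x, by simpa using hx, rfl⟩),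
    fun x => ?_⟩
  have h1 : Φ x = φ x := DFunLike.congr_fun hΦ x
  have h2 := hGQ (φ x)
  rw [Function.comp_apply, hφ] at h2
  change dist (G' (Φ x)) (Q (f x)) < δ
  rwa [h1, hEq (show φ x ∈ ι ⁻¹' range f from ⟨x, (hφ x).symm⟩)]

end Sphere

/-- Let `n ≥ 1` and let `f : Sⁿ → Sⁿ⁺¹` be a continuous map.  If the set
of injectivity of `f` contains a nonempty open subset of `Sⁿ`, then `f(Sⁿ)` separates
`Sⁿ⁺¹`: the complement of the image is nonempty and is not a connected set. -/
theorem sphere_map_image_separates_of_open_injectivity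
    (n : ℕ) (hn : 1 ≤ n)
    (f : (Metric.sphere (0 : EuclideanSpace ℝ (Fin (n + 1))) 1) →
         (Metric.sphere (0 : EuclideanSpace ℝ (Fin (n + 2))) 1))
    (hf : Continuous f)
    (U : Set (Metric.sphere (0 : EuclideanSpace ℝ (Fin (n + 1))) 1))
    (hUopen : IsOpen U) (hUne : U.Nonempty)
    (hUinj : ∀ p ∈ U, ∀ q, f q = f p → q = p) :
    (Set.range f)ᶜ.Nonempty ∧ ¬ IsPreconnected (Set.range f)ᶜ := by
  obtain ⟨c, w, δ, hc, hδ, hw, hseg⟩ := exists_collapse_compl_of_isOpen hUopen hUne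
  obtain ⟨Q, hQ⟩ := exists_continuousMap_comp_eq hf hUinj hc hw
  have hcδ : ∀ x, δ ≤ ‖Q (f x)‖ := fun x => by
    simpa [hQ] using hseg x 1 ⟨zero_le_one, le_rfl⟩
  have hnonempty : (Set.range f)ᶜ.Nonempty := by
    rw [nonempty_compl]
    intro hsurj
    obtain ⟨F, hF, hne, hdist⟩ := exists_nonvanishing_approx_of_finrank_lt (by simp) hf Q
      (fun y h0 => by
        obtain ⟨x, rfl⟩ := range_eq_univ.1 hsurj y
        exact (norm_pos_iff.1 (hδ.trans_le (hcδ x))) h0) hδ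
    exact not_exists_nonvanishing_approx hseg hF (fun x _ => hne x) fun x => hQ x ▸ hdist x
  refine ⟨hnonempty, fun hconn => ?_⟩
  obtain ⟨v, hv⟩ := hnonempty
  have : Fact (Module.finrank ℝ (EuclideanSpace ℝ (Fin (n + 2))) = n + 1 + 1) := ⟨by simp⟩
  have htarget : (stereographic' (n + 1) v).symm.source = univ := by simp
  have hrange : range (stereographic' (n + 1) v).symm = {v}ᶜ := by
    rw [← image_univ, ← stereographic'_target v,
      (stereographic' (n + 1) v).symm_image_target_eq_source, stereographic'_source]
  obtain ⟨F, hF, hne, hdist⟩ := exists_nonvanishing_approx_of_isPreconnected_compl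
    ((stereographic' (n + 1) v).symm.isOpenEmbedding htarget) hrange hf hv hconn Q hδ hcδ
  exact not_exists_nonvanishing_approx hseg hF hne fun x => hQ x ▸ hdist x
end
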